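/- Let n ≥ 4 be an integer and p a prime. The number of ordered pairs (C, C') with C, C' ∈ R^(n)(p) = R₀^(n)(p) ∪ R₁^(n)(p) such that the product C·C' belongs to the right coset Λ_n·diag(1, p², …, p², p⁴) (with n−2 middle entries equal to p²) equals 1. -/

import Mathlib

open Matrix

/-- `Λ_n = GL_n(ℤ)` viewed inside the `n × n` rational matrices: the matrices with integer
entries whose determinant is `±1`. -/
def Lambda (n : ℕ) : Set (Matrix (Fin n) (Fin n) ℚ) :=
  {γ | (∀ i j, ∃ z : ℤ, γ i j = (z : ℚ)) ∧ (γ.det = 1 ∨ γ.det = -1)}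

/-- The right coset `Λ_n h = {γ * h : γ ∈ Λ_n}`. -/
def rightCoset (n : ℕ) (h : Matrix (Fin n) (Fin n) ℚ) : Set (Matrix (Fin n) (Fin n) ℚ) :=
  {m | ∃ γ ∈ Lambda n, m = γ * h}

/-- The double coset `Λ_n g Λ_n = {γ₁ * g * γ₂ : γ₁, γ₂ ∈ Λ_n}`. -/
def doubleCoset (n : ℕ) (g : Matrix (Fin n) (Fin n) ℚ) : Set (Matrix (Fin n) (Fin n) ℚ) :=
  {m | ∃ γ₁ ∈ Lambda n, ∃ γ₂ ∈ Lambda n, m = γ₁ * g * γ₂}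

/-- The degree of `g`: the number of distinct right cosets `Λ_n h` contained in `Λ_n g Λ_n`. -/
noncomputable def degree (n : ℕ) (g : Matrix (Fin n) (Fin n) ℚ) : ℕ :=
  Set.ncard {S : Set (Matrix (Fin n) (Fin n) ℚ) | ∃ h ∈ doubleCoset n g, S = rightCoset n h}

/-- The `k`-th determinantal divisor of an `n × n` integer matrix: the gcd of all of its
`k × k` minors (which is `0` when all these minors vanish), a minor being indexed by a pair
of strictly increasing maps `Fin k → Fin n` selecting rows and columns. -/
def detDiv (n k : ℕ) (C : Matrix (Fin n) (Fin n) ℤ) : ℤ :=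
  Finset.gcd ((Finset.univ : Finset ((Fin k → Fin n) × (Fin k → Fin n))).filter
      (fun fg => (∀ a b : Fin k, a < b → fg.1 a < fg.1 b) ∧
        (∀ a b : Fin k, a < b → fg.2 a < fg.2 b)))
    (fun fg => (C.submatrix fg.1 fg.2).det)

/-- `D^(n)(p) = diag(1, p, …, p, p²)` with `n - 2` middle diagonal entries equal to `p`. -/
def Dmat (n p : ℕ) : Matrix (Fin n) (Fin n) ℤ :=
  Matrix.diagonal (fun i => if i.val = 0 then 1 else if i.val = n - 1 then (p : ℤ) ^ 2 else (p : ℤ))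

/-- The set `R₀^(n)(p)` of upper-triangular integer matrices whose determinantal divisors are
`d_k = p^(k-1)` for `1 ≤ k ≤ n - 1` and `d_n = p^n`, whose diagonal entries all equal `p`, and
whose above-diagonal entries lie in `[0, p)`. -/
def R0 (n p : ℕ) : Set (Matrix (Fin n) (Fin n) ℤ) :=
  {C | (∀ i j : Fin n, j < i → C i j = 0) ∧
    (∀ k : ℕ, 1 ≤ k → k ≤ n - 1 → detDiv n k C = (p : ℤ) ^ (k - 1)) ∧
    detDiv n n C = (p : ℤ) ^ n ∧
    (∀ i : Fin n, C i i = (p : ℤ)) ∧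
    (∀ i j : Fin n, i < j → 0 ≤ C i j ∧ C i j < (p : ℤ))}

/-- The set `R₁^(n)(p)` of upper-triangular integer matrices whose diagonal entries lie in
`{1, p, p²}` with exactly one entry `1` and exactly one entry `p²`, whose above-diagonal
entries satisfy `0 ≤ c i j < c j j`, and such that `p ∣ c i i` implies `p ∣ c i j` for `j > i`. -/
def R1 (n p : ℕ) : Set (Matrix (Fin n) (Fin n) ℤ) :=
  {C | (∀ i j : Fin n, j < i → C i j = 0) ∧
    (∀ i : Fin n, C i i = 1 ∨ C i i = (p : ℤ) ∨ C i i = (p : ℤ) ^ 2) ∧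
    (∃! i : Fin n, C i i = 1) ∧
    (∃! i : Fin n, C i i = (p : ℤ) ^ 2) ∧
    (∀ i j : Fin n, i < j → 0 ≤ C i j ∧ C i j < C j j) ∧
    (∀ i j : Fin n, i < j → (p : ℤ) ∣ C i i → (p : ℤ) ∣ C i j)}

/-- Casting an integer matrix to a rational matrix. -/
def toQ (n : ℕ) (C : Matrix (Fin n) (Fin n) ℤ) : Matrix (Fin n) (Fin n) ℚ :=
  C.map (fun z : ℤ => (z : ℚ))

/-- The diagonal of `diag(1, p², …, p², p⁴)`. -/
def outerDiag (n p : ℕ) (i : Fin n) : ℤ :=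
  if i.val = 0 then 1 else if i.val = n - 1 then (p : ℤ) ^ 4 else (p : ℤ) ^ 2

lemma outerDiag_pos {n p : ℕ} (hp : p.Prime) (i : Fin n) : 0 < outerDiag n p i := by
  have : (0 : ℤ) < p := by exact_mod_cast hp.pos
  unfold outerDiag
  split_ifs <;> positivity

lemma diagonal_cast_outerDiag (n p : ℕ) :
    (Matrix.diagonal fun i : Fin n =>
      if i.val = 0 then (1 : ℚ) else if i.val = n - 1 then (p : ℚ) ^ 4 else (p : ℚ) ^ 2) =
    Matrix.diagonal fun i => (outerDiag n p i : ℚ) := by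
  congr 1
  funext i
  unfold outerDiag
  split_ifs <;> simp

/-- An upper-triangular matrix with positive diagonal in the right coset of a diagonal matrix
has the same diagonal, and each of its columns is divisible by the diagonal entry. -/
lemma diag_eq_and_dvd_of_mem_rightCoset {n : ℕ} {A : Matrix (Fin n) (Fin n) ℤ} {e : Fin n → ℤ}
    (he : ∀ i, 0 < e i) (hA : ∀ i j, j < i → A i j = 0) (hpos : ∀ i, 0 < A i i)
    (h : toQ n A ∈ rightCoset n (Matrix.diagonal fun i => (e i : ℚ))) :
    (∀ i, A i i = e i) ∧ ∀ i j, e j ∣ A i j := by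
  obtain ⟨γ, ⟨hint, hdet⟩, hγ⟩ := h
  choose Z hZ using hint
  have hmap : γ = (Matrix.of Z).map (Int.castRingHom ℚ) := by
    ext i j
    simp [hZ]
  have hent (i j : Fin n) : A i j = Z i j * e j := by
    have := congrFun (congrFun hγ i) j
    rw [Matrix.mul_diagonal, hZ] at this
    simp only [toQ, Matrix.map_apply] at this
    exact_mod_cast this
  have hdet' : (Matrix.of Z).det = ∏ i, Z i i := by
    refine Matrix.det_of_isUpperTriangular fun i j hij => ?_
    have := hA i j hij
    rw [hent] at this
    exact (mul_eq_zero.mp this).resolve_right (he j).ne'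
  have hunit : IsUnit (∏ i, Z i i) := by
    rw [Int.isUnit_iff, ← hdet']
    rw [hmap, ← RingHom.mapMatrix_apply, ← RingHom.map_det] at hdet
    simp only [eq_intCast] at hdet
    exact_mod_cast hdet
  refine ⟨fun i => ?_, fun i j => ⟨Z i j, by rw [hent, mul_comm]⟩⟩
  have hi : IsUnit (Z i i) :=
    isUnit_of_dvd_unit (Finset.dvd_prod_of_mem (fun k => Z k k) (Finset.mem_univ i)) hunit
  have hp := hpos i
  rcases Int.isUnit_iff.mp hi with h1 | h1
  · rw [hent, h1, one_mul]
  · rw [hent, h1] at hp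
    linarith [he i]

lemma diag_of_mem_R0_union_R1 {n p : ℕ} {C : Matrix (Fin n) (Fin n) ℤ} (h : C ∈ R0 n p ∪ R1 n p)
    (i : Fin n) : C i i = 1 ∨ C i i = (p : ℤ) ∨ C i i = (p : ℤ) ^ 2 := by
  rcases h with h | h
  · exact Or.inr (Or.inl (h.2.2.2.1 i))
  · exact h.2.1 i

lemma upperTriangular_of_mem_R0_union_R1 {n p : ℕ} {C : Matrix (Fin n) (Fin n) ℤ}
    (h : C ∈ R0 n p ∪ R1 n p) (i j : Fin n) (hij : j < i) : C i j = 0 :=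
  h.elim (fun h => h.1 i j hij) (fun h => h.1 i j hij)

lemma mem_R1_of_diag_eq_one {n p : ℕ} (hp : p.Prime) {C : Matrix (Fin n) (Fin n) ℤ}
    (h : C ∈ R0 n p ∪ R1 n p) {i : Fin n} (hi : C i i = 1) : C ∈ R1 n p := by
  rcases h with h | h
  · have h1 := h.2.2.2.1 i
    rw [hi] at h1
    exact absurd (by exact_mod_cast h1.symm) hp.one_lt.ne'
  · exact h

lemma mul_apply_of_upperTriangular_self {n : ℕ} {A B : Matrix (Fin n) (Fin n) ℤ}
    (hA : ∀ i j, j < i → A i j = 0) (hB : ∀ i j, j < i → B i j = 0) (i : Fin n) :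
    (A * B) i i = A i i * B i i := by
  rw [Matrix.mul_apply, Fintype.sum_eq_single i]
  intro k hk
  rcases lt_or_gt_of_ne hk with h | h
  · rw [hA i k h, zero_mul]
  · rw [hB k i h, mul_zero]

lemma mul_apply_of_upperTriangular {n : ℕ} {A B : Matrix (Fin n) (Fin n) ℤ}
    (hA : ∀ i j, j < i → A i j = 0) (hB : ∀ i j, j < i → B i j = 0) {i j : Fin n} (hij : i < j)
    (h : ∀ k, i < k → k < j → A i k * B k j = 0) :
    (A * B) i j = A i i * B i j + A i j * B j j := by
  rw [Matrix.mul_apply, Fintype.sum_eq_add i j hij.ne]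
  rintro k ⟨hki, hkj⟩
  rcases lt_or_gt_of_ne hki with h1 | h1
  · rw [hA i k h1, zero_mul]
  rcases lt_or_gt_of_ne hkj with h2 | h2
  · exact h k h1 h2
  · rw [hB k j h2, mul_zero]

lemma eq_zero_of_sq_dvd_add_mul {a b m : ℤ} (ha : 0 ≤ a) (ham : a < m) (hb : 0 ≤ b) (hbm : b < m)
    (h : m ^ 2 ∣ a + b * m) : a = 0 ∧ b = 0 := by
  have hm : 0 < m := ha.trans_lt ham
  have h0 : a + b * m = 0 := Int.eq_zero_of_dvd_of_nonneg_of_lt (by positivity) (by nlinarith) h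
  have hbm0 : 0 ≤ b * m := by positivity
  have : b * m = 0 := by linarith
  exact ⟨by linarith, (mul_eq_zero.mp this).resolve_right hm.ne'⟩

lemma Dmat_mem_R1 {n p : ℕ} (hn : 2 ≤ n) (hp : p.Prime) : Dmat n p ∈ R1 n p := by
  have hp1 : (1 : ℤ) < p := by exact_mod_cast hp.one_lt
  have hp2 : (p : ℤ) < (p : ℤ) ^ 2 := by nlinarith
  have hoff (i j : Fin n) (hij : i ≠ j) : Dmat n p i j = 0 := Matrix.diagonal_apply_ne _ hij
  have hdiag (i : Fin n) : Dmat n p i i =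
      if i.val = 0 then 1 else if i.val = n - 1 then (p : ℤ) ^ 2 else (p : ℤ) :=
    Matrix.diagonal_apply_eq _ i
  refine ⟨fun i j h => hoff i j h.ne', fun i => ?_, ⟨⟨0, by omega⟩, ?_, fun i hi => ?_⟩,
    ⟨⟨n - 1, by omega⟩, ?_, fun i hi => ?_⟩, fun i j h => ?_, fun i j h _ => ?_⟩
  · rw [hdiag]
    split_ifs <;> simp
  · simp [hdiag]
  · simp only [hdiag] at hi
    split_ifs at hi with h1 h2
    · exact Fin.ext h1
    all_goals linarith
  · have : n - 1 ≠ 0 := by omega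
    simp [hdiag, this]
  · simp only [hdiag] at hi
    split_ifs at hi with h1 h2
    · linarith
    · exact Fin.ext h2
    · linarith
  · rw [hoff i j h.ne, hdiag]
    refine ⟨le_rfl, ?_⟩
    split_ifs <;> linarith
  · rw [hoff i j h.ne]
    exact dvd_zero _

/-- A pair in `R₁` whose first diagonal entries are `1` and whose product has diagonal
`(1, p², …, p², p⁴)`, with each column divisible by its diagonal entry, is `(D, D)`. -/
lemma eq_Dmat_of_mem_R1 {n p : ℕ} (hn : 2 ≤ n) (hp : p.Prime) {A B : Matrix (Fin n) (Fin n) ℤ}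
    (hA : A ∈ R1 n p) (hB : B ∈ R1 n p) (hA0 : ∀ i : Fin n, i.val = 0 → A i i = 1)
    (hB0 : ∀ i : Fin n, i.val = 0 → B i i = 1)
    (hdiag : ∀ i, A i i * B i i = outerDiag n p i)
    (hdvd : ∀ i j, outerDiag n p j ∣ (A * B) i j) :
    A = Dmat n p ∧ B = Dmat n p := by
  obtain ⟨uA, dA, oA, -, bA, vA⟩ := hA
  obtain ⟨uB, dB, oB, -, bB, vB⟩ := hB
  have hp1 : (1 : ℤ) < p := by exact_mod_cast hp.one_lt
  have hp0 : (0 : ℤ) < p := by linarith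
  have hp2 : (p : ℤ) < (p : ℤ) ^ 2 := by nlinarith
  have hp3 : (p : ℤ) ^ 2 < (p : ℤ) ^ 3 := by nlinarith
  have hp4 : (p : ℤ) ^ 3 < (p : ℤ) ^ 4 := by nlinarith [pow_pos hp0 3]
  have hval (i : Fin n) : A i i = Dmat n p i i ∧ B i i = Dmat n p i i := by
    rw [Dmat, Matrix.diagonal_apply_eq]
    by_cases hi : i.val = 0
    · simp [hA0 i hi, hB0 i hi, hi]
    have hAi : A i i ≠ 1 := fun h =>
      hi (congrArg Fin.val (oA.unique h (hA0 ⟨0, by omega⟩ rfl)))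
    have hBi : B i i ≠ 1 := fun h =>
      hi (congrArg Fin.val (oB.unique h (hB0 ⟨0, by omega⟩ rfl)))
    have h := hdiag i
    rw [outerDiag, if_neg hi] at h
    rw [if_neg hi]
    rcases (dA i).resolve_left hAi with h1 | h1 <;> rcases (dB i).resolve_left hBi with h2 | h2 <;>
      rw [h1, h2] at h ⊢ <;> split_ifs at h ⊢ <;> first | exact ⟨rfl, rfl⟩ | (exfalso; nlinarith)
  have hlast (i : Fin n) (hi : i.val ≠ 0) (hi' : i.val = n - 1) :
      outerDiag n p i = (p : ℤ) ^ 4 ∧ A i i = (p : ℤ) ^ 2 ∧ B i i = (p : ℤ) ^ 2 := by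
    simp only [hval, outerDiag, Dmat, Matrix.diagonal_apply_eq, if_neg hi, if_pos hi', and_self]
  have hmid (i : Fin n) (hi : i.val ≠ 0) (hi' : i.val ≠ n - 1) :
      outerDiag n p i = (p : ℤ) ^ 2 ∧ A i i = (p : ℤ) ∧ B i i = (p : ℤ) := by
    simp only [hval, outerDiag, Dmat, Matrix.diagonal_apply_eq, if_neg hi, if_neg hi', and_self]
  have hinner (i j : Fin n) (hij : i < j) (hi : i.val ≠ 0) (hj : j.val ≠ n - 1) :
      A i j = 0 ∧ B i j = 0 := by
    obtain ⟨-, a1, b1⟩ := hmid i hi (by omega)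
    obtain ⟨-, a2, b2⟩ := hmid j (by omega) hj
    have hA := bA i j hij
    have hB := bB i j hij
    rw [a2] at hA
    rw [b2] at hB
    exact ⟨Int.eq_zero_of_dvd_of_nonneg_of_lt hA.1 hA.2 (vA i j hij (by rw [a1])),
      Int.eq_zero_of_dvd_of_nonneg_of_lt hB.1 hB.2 (vB i j hij (by rw [b1]))⟩
  have hfirst (i j : Fin n) (hij : i < j) (hi : i.val = 0) (hj : j.val ≠ n - 1) :
      A i j = 0 ∧ B i j = 0 := by
    obtain ⟨e2, a2, b2⟩ := hmid j (by omega) hj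
    have h := hdvd i j
    rw [mul_apply_of_upperTriangular uA uB hij
      (fun k h1 h2 => by rw [(hinner k j h2 (by omega) hj).2, mul_zero]), e2, hA0 i hi, b2, one_mul] at h
    have hA := bA _ j hij
    have hB := bB _ j hij
    rw [a2] at hA
    rw [b2] at hB
    exact (eq_zero_of_sq_dvd_add_mul hB.1 hB.2 hA.1 hA.2 h).symm
  have hoff (i j : Fin n) (hij : i < j) : A i j = 0 ∧ B i j = 0 := by
    by_cases hj : j.val = n - 1
    · obtain ⟨e2, a2, b2⟩ := hlast j (by omega) hj
      have h := hdvd i j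
      have hA := bA i j hij
      have hB := bB i j hij
      rw [a2] at hA
      rw [b2] at hB
      have hz (k : Fin n) (h1 : i < k) (h2 : k < j) : A i k * B k j = 0 := by
        have : A i k = 0 := by
          by_cases hi : i.val = 0
          · exact (hfirst i k h1 hi (by omega)).1
          · exact (hinner i k h1 hi (by omega)).1
        rw [this, zero_mul]
      rw [mul_apply_of_upperTriangular uA uB hij hz, e2, b2] at h
      by_cases hi : i.val = 0
      · rw [hA0 i hi, one_mul] at h
        refine (eq_zero_of_sq_dvd_add_mul hB.1 hB.2 hA.1 hA.2 ?_).symm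
        rwa [← pow_mul]
      · obtain ⟨-, a1, b1⟩ := hmid i hi (by omega)
        obtain ⟨a, ha⟩ := vA i j hij (by rw [a1])
        obtain ⟨b, hb⟩ := vB i j hij (by rw [b1])
        rw [a1, ha, hb] at h
        rw [ha, sq] at hA
        rw [hb, sq] at hB
        have h' : (p : ℤ) ^ 2 * (p : ℤ) ^ 2 ∣ (p : ℤ) ^ 2 * (b + a * p) := by
          convert h using 1 <;> ring
        have := eq_zero_of_sq_dvd_add_mul (nonneg_of_mul_nonneg_right hB.1 hp0)
          (lt_of_mul_lt_mul_left hB.2 hp0.le) (nonneg_of_mul_nonneg_right hA.1 hp0)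
          (lt_of_mul_lt_mul_left hA.2 hp0.le) (Int.dvd_of_mul_dvd_mul_left (by positivity) h')
        rw [ha, hb, this.1, this.2]
        simp
    · by_cases hi : i.val = 0
      · exact hfirst i j hij hi hj
      · exact hinner i j hij hi hj
  constructor <;> ext i j <;> rcases lt_trichotomy i j with h | rfl | h
  · rw [(hoff i j h).1, Dmat, Matrix.diagonal_apply_ne _ h.ne]
  · exact (hval i).1
  · rw [uA i j h, Dmat, Matrix.diagonal_apply_ne _ h.ne']
  · rw [(hoff i j h).2, Dmat, Matrix.diagonal_apply_ne _ h.ne]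
  · exact (hval i).2
  · rw [uB i j h, Dmat, Matrix.diagonal_apply_ne _ h.ne']

lemma Dmat_mul_Dmat_mem_rightCoset (n p : ℕ) :
    toQ n (Dmat n p * Dmat n p) ∈
      rightCoset n (Matrix.diagonal fun i => (outerDiag n p i : ℚ)) := by
  refine ⟨1, ⟨fun i j => ⟨(1 : Matrix (Fin n) (Fin n) ℤ) i j, ?_⟩, by simp⟩, ?_⟩
  · simp only [Matrix.one_apply]
    split_ifs <;> simp
  · rw [one_mul, Dmat, Matrix.diagonal_mul_diagonal, toQ, Matrix.diagonal_map (by simp)]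
    congr 1
    funext i
    simp only [outerDiag]
    split_ifs <;> push_cast <;> ring

theorem statement17 (n p : ℕ) (hn : 4 ≤ n) (hp : p.Prime) :
    {CC : Matrix (Fin n) (Fin n) ℤ × Matrix (Fin n) (Fin n) ℤ |
        CC.1 ∈ R0 n p ∪ R1 n p ∧ CC.2 ∈ R0 n p ∪ R1 n p ∧
        toQ n (CC.1 * CC.2) ∈ rightCoset n (Matrix.diagonal fun i : Fin n =>
      if i.val = 0 then (1 : ℚ) else if i.val = n - 1 then (p : ℚ) ^ 4 else (p : ℚ) ^ 2)}.ncard =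
      1 := by
  rw [diagonal_cast_outerDiag, Set.ncard_eq_one]
  refine ⟨(Dmat n p, Dmat n p), Set.eq_singleton_iff_unique_mem.mpr ⟨?_, ?_⟩⟩
  · have h := Dmat_mem_R1 (n := n) (by omega) hp
    exact ⟨Or.inr h, Or.inr h, Dmat_mul_Dmat_mem_rightCoset n p⟩
  · rintro ⟨A, B⟩ ⟨hA, hB, hAB⟩
    dsimp only at hA hB hAB
    have hp0 : (0 : ℤ) < p := by exact_mod_cast hp.pos
    have uA := upperTriangular_of_mem_R0_union_R1 hA
    have uB := upperTriangular_of_mem_R0_union_R1 hB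
    have pA (i : Fin n) : 0 < A i i := by
      rcases diag_of_mem_R0_union_R1 hA i with h | h | h <;> rw [h] <;> positivity
    have pB (i : Fin n) : 0 < B i i := by
      rcases diag_of_mem_R0_union_R1 hB i with h | h | h <;> rw [h] <;> positivity
    have hself := mul_apply_of_upperTriangular_self uA uB
    obtain ⟨hdiag, hdvd⟩ := diag_eq_and_dvd_of_mem_rightCoset (outerDiag_pos hp)
      (fun i j hij => Matrix.BlockTriangular.mul (b := id) (fun i j h => uA i j h)
        (fun i j h => uB i j h) hij)
      (fun i => by rw [hself]; exact mul_pos (pA i) (pB i)) hAB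
    simp only [hself] at hdiag
    have h00 (i : Fin n) (hi : i.val = 0) : A i i * B i i = 1 := by
      rw [hdiag, outerDiag, if_pos hi]
    have hA0 (i : Fin n) (hi : i.val = 0) : A i i = 1 :=
      Int.eq_one_of_mul_eq_one_right (pA i).le (h00 i hi)
    have hB0 (i : Fin n) (hi : i.val = 0) : B i i = 1 :=
      Int.eq_one_of_mul_eq_one_left (pB i).le (h00 i hi)
    obtain ⟨h1, h2⟩ := eq_Dmat_of_mem_R1 (by omega) hp (mem_R1_of_diag_eq_one hp hA (hA0 ⟨0, by omega⟩ rfl))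
      (mem_R1_of_diag_eq_one hp hB (hB0 ⟨0, by omega⟩ rfl)) hA0 hB0 hdiag hdvd
    rw [h1, h2]
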